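/- arXiv:solv-int/9701008 — 2 statements merged into one kernel-verified Lean document; each statement's English description precedes it below -/
import Mathlib

section
/- Let w : ℝ³ → ℝ be a smooth solution of the KP₄ equation and let f, g, h, ℓ : ℝ → ℝ be smooth. Define Q : ℝ³ → ℝ by Q = f(t)∂_t w + (1/4)f'(t)(x∂ₓw + 2y∂_yw) + (1/4)(w f'(t) + x y f''(t)) + g(t)∂_y w + (1/2)x g'(t) + h(t)∂ₓ w + y h'(t) + ℓ(t). Then Q satisfies the linearized KP₄ equation at w; that is, the full point symmetry algebra T(f) + Y(g) + X(h) + U(ℓ) of KP₄ consists of symmetries. -/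
noncomputable section

/-- Partial derivative in the first variable `x`. -/
def dx (w : ℝ → ℝ → ℝ → ℝ) : ℝ → ℝ → ℝ → ℝ :=
  fun x y t => deriv (fun s => w s y t) x

/-- Partial derivative in the second variable `y`. -/
def dy (w : ℝ → ℝ → ℝ → ℝ) : ℝ → ℝ → ℝ → ℝ :=
  fun x y t => deriv (fun s => w x s t) y

/-- Partial derivative in the third variable `t`. -/
def dt (w : ℝ → ℝ → ℝ → ℝ) : ℝ → ℝ → ℝ → ℝ :=
  fun x y t => deriv (fun s => w x y s) t

/-- Smoothness of a function of three real variables. -/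
def Smooth3 (w : ℝ → ℝ → ℝ → ℝ) : Prop :=
  ContDiff ℝ (⊤ : ℕ∞) (fun p : ℝ × ℝ × ℝ => w p.1 p.2.1 p.2.2)

/-- The fourth equation of the KP hierarchy (KP₄). -/
def KP4 (w : ℝ → ℝ → ℝ → ℝ) : Prop :=
  ∀ x y t,
      dx (dx (dx (dx (dy w)))) x y t
    + 6 * dx (dx w) x y t * dx (dy w) x y t
    + 4 * dx w x y t * dx (dx (dy w)) x y t
    + 2 * dx (dx (dx w)) x y t * dy w x y t
    - 2 * dx (dx (dt w)) x y t
    + dy (dy (dy w)) x y t = 0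

/-- The linearization of the KP₄ equation at a solution `w`. -/
def LinKP4 (w Q : ℝ → ℝ → ℝ → ℝ) : Prop :=
  ∀ x y t,
      dx (dx (dx (dx (dy Q)))) x y t
    + 6 * (dx (dx Q) x y t * dx (dy w) x y t + dx (dx w) x y t * dx (dy Q) x y t)
    + 4 * (dx Q x y t * dx (dx (dy w)) x y t + dx w x y t * dx (dx (dy Q)) x y t)
    + 2 * (dx (dx (dx Q)) x y t * dy w x y t + dx (dx (dx w)) x y t * dy Q x y t)
    - 2 * dx (dx (dt Q)) x y t
    + dy (dy (dy Q)) x y t = 0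

/-- The algebra of smooth real-valued functions on a normed space. -/
def smoothFunctions (E : Type*) [NormedAddCommGroup E] [NormedSpace ℝ E] :
    Subalgebra ℝ (E → ℝ) where
  carrier := {a | ContDiff ℝ (⊤ : ℕ∞) a}
  mul_mem' {a b} (ha : ContDiff ℝ (⊤ : ℕ∞) a) (hb : ContDiff ℝ (⊤ : ℕ∞) b) :=
    show ContDiff ℝ (⊤ : ℕ∞) (a * b) from ha.mul hb
  add_mem' {a b} (ha : ContDiff ℝ (⊤ : ℕ∞) a) (hb : ContDiff ℝ (⊤ : ℕ∞) b) :=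
    show ContDiff ℝ (⊤ : ℕ∞) (a + b) from ha.add hb
  algebraMap_mem' r := show ContDiff ℝ (⊤ : ℕ∞) (fun _ : E => r) from contDiff_const

section DirectionalDerivative

variable {E : Type*} [NormedAddCommGroup E] [NormedSpace ℝ E]

theorem smoothFunctions_contDiff (a : smoothFunctions E) :
    ContDiff ℝ (⊤ : ℕ∞) (a : E → ℝ) := a.2

theorem smoothFunctions_differentiableAt (a : smoothFunctions E) (p : E) :
    DifferentiableAt ℝ (a : E → ℝ) p :=
  (smoothFunctions_contDiff a).differentiable (by simp) p

/-- The directional derivative along `v`, as a derivation of the algebra of smooth functions. -/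
def dirDeriv (v : E) : Derivation ℝ (smoothFunctions E) (smoothFunctions E) :=
  Derivation.mk'
    { toFun := fun a => ⟨fun p => fderiv ℝ (a : E → ℝ) p v,
        ((smoothFunctions_contDiff a).fderiv_right (m := (⊤ : ℕ∞)) (by simp)).clm_apply contDiff_const⟩
      map_add' := fun a b => by
        ext p
        change fderiv ℝ ((a : E → ℝ) + (b : E → ℝ)) p v = fderiv ℝ a p v + fderiv ℝ b p v
        rw [fderiv_add (smoothFunctions_differentiableAt a p) (smoothFunctions_differentiableAt b p)]
        rfl
      map_smul' := fun c a => by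
        ext p
        change fderiv ℝ (c • (a : E → ℝ)) p v = c • fderiv ℝ a p v
        rw [fderiv_const_smul (smoothFunctions_differentiableAt a p)]
        rfl }
    fun a b => by
      ext p
      change fderiv ℝ ((a : E → ℝ) * (b : E → ℝ)) p v
        = (a : E → ℝ) p * fderiv ℝ b p v + (b : E → ℝ) p * fderiv ℝ a p v
      rw [fderiv_mul (smoothFunctions_differentiableAt a p) (smoothFunctions_differentiableAt b p)]
      rfl

theorem dirDeriv_comm (u v : E) (a : smoothFunctions E) :
    dirDeriv u (dirDeriv v a) = dirDeriv v (dirDeriv u a) := by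
  have hd : ∀ p, DifferentiableAt ℝ (fderiv ℝ (a : E → ℝ)) p := fun p =>
    ((smoothFunctions_contDiff a).fderiv_right (m := (⊤ : ℕ∞)) (by simp)).differentiable (by simp) p
  have key : ∀ (u v p : E), (dirDeriv u (dirDeriv v a) : E → ℝ) p
      = fderiv ℝ (fderiv ℝ (a : E → ℝ)) p u v := by
    intro u v p
    change fderiv ℝ (fun q => fderiv ℝ (a : E → ℝ) q v) p u = _
    rw [fderiv_clm_apply (hd p) (differentiableAt_const v)]
    simp
  ext p
  rw [key, key]
  exact (((smoothFunctions_contDiff a).contDiffAt (x := p)).isSymmSndFDerivAt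
    (by simpa using WithTop.coe_le_coe.2 (le_top : (2 : ℕ∞) ≤ ⊤))) u v

end DirectionalDerivative

/-- The point symmetries of KP₄, in a commutative ring with three commuting derivations. -/
theorem linearized_KP4_of_derivations {A : Type*} [CommRing A] [Algebra ℝ A]
    (Dx Dy Dt : Derivation ℝ A A)
    (hxy : ∀ a, Dx (Dy a) = Dy (Dx a)) (hxt : ∀ a, Dx (Dt a) = Dt (Dx a))
    (hyt : ∀ a, Dy (Dt a) = Dt (Dy a))
    {c X Y F G H L w Q : A} (hc : 4 * c = 1)
    (hcx : Dx c = 0) (hcy : Dy c = 0) (hct : Dt c = 0)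
    (hXx : Dx X = 1) (hXy : Dy X = 0) (hXt : Dt X = 0)
    (hYx : Dx Y = 0) (hYy : Dy Y = 1) (hYt : Dt Y = 0)
    (hFx : Dx F = 0) (hFy : Dy F = 0) (hGx : Dx G = 0) (hGy : Dy G = 0)
    (hHx : Dx H = 0) (hHy : Dy H = 0) (hLx : Dx L = 0) (hLy : Dy L = 0)
    (hw : Dx (Dx (Dx (Dx (Dy w)))) + 6 * Dx (Dx w) * Dx (Dy w) + 4 * Dx w * Dx (Dx (Dy w))
      + 2 * Dx (Dx (Dx w)) * Dy w - 2 * Dx (Dx (Dt w)) + Dy (Dy (Dy w)) = 0)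
    (hQ : Q = F * Dt w + c * Dt F * (X * Dx w + 2 * Y * Dy w)
      + c * (w * Dt F + X * Y * Dt (Dt F)) + G * Dy w + 2 * c * X * Dt G
      + H * Dx w + Y * Dt H + L) :
    Dx (Dx (Dx (Dx (Dy Q)))) + 6 * (Dx (Dx Q) * Dx (Dy w) + Dx (Dx w) * Dx (Dy Q))
      + 4 * (Dx Q * Dx (Dx (Dy w)) + Dx w * Dx (Dx (Dy Q)))
      + 2 * (Dx (Dx (Dx Q)) * Dy w + Dx (Dx (Dx w)) * Dy Q)
      - 2 * Dx (Dx (Dt Q)) + Dy (Dy (Dy Q)) = 0 := by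
  have n2 : ∀ D : Derivation ℝ A A, D 2 = 0 := fun D => by exact_mod_cast D.map_natCast 2
  have n4 : ∀ D : Derivation ℝ A A, D 4 = 0 := fun D => by exact_mod_cast D.map_natCast 4
  have n6 : ∀ D : Derivation ℝ A A, D 6 = 0 := fun D => by exact_mod_cast D.map_natCast 6
  have hwx := congrArg Dx hw
  have hwy := congrArg Dy hw
  have hwt := congrArg Dt hw
  subst hQ
  simp only [map_add, map_sub, map_zero, Derivation.leibniz, smul_eq_mul, n2, n4, n6, hxy, hxt, hyt,
    hcx, hcy, hct, hXx, hXy, hXt, hYx, hYy, hYt, hFx, hFy, hGx, hGy, hHx, hHy, hLx, hLy,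
    mul_zero, add_zero, zero_add, mul_one]
    at hw hwx hwy hwt ⊢
  linear_combination F * hwt + (c * Dt F * X + H) * hwx + (2 * c * Dt F * Y + G) * hwy
    + 7 * c * Dt F * hw
    + 2 * (Dt F * Dt (Dx (Dx w)) + Dt G * Dy (Dx (Dx w))) * hc

/-- The curried form of a smooth function on `ℝ × ℝ × ℝ`. -/
def curry3 (a : smoothFunctions (ℝ × ℝ × ℝ)) : ℝ → ℝ → ℝ → ℝ :=
  fun x y t => (a : ℝ × ℝ × ℝ → ℝ) (x, y, t)

theorem dx_curry3 (a : smoothFunctions (ℝ × ℝ × ℝ)) :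
    dx (curry3 a) = curry3 (dirDeriv (1, 0, 0) a) := by
  funext x y t
  exact ((smoothFunctions_differentiableAt a (x, y, t)).hasFDerivAt.comp_hasDerivAt x
    ((hasDerivAt_id x).prodMk (hasDerivAt_const x (y, t)))).deriv

theorem dy_curry3 (a : smoothFunctions (ℝ × ℝ × ℝ)) :
    dy (curry3 a) = curry3 (dirDeriv (0, 1, 0) a) := by
  funext x y t
  exact ((smoothFunctions_differentiableAt a (x, y, t)).hasFDerivAt.comp_hasDerivAt y
    ((hasDerivAt_const y x).prodMk ((hasDerivAt_id y).prodMk (hasDerivAt_const y t)))).deriv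

theorem dt_curry3 (a : smoothFunctions (ℝ × ℝ × ℝ)) :
    dt (curry3 a) = curry3 (dirDeriv (0, 0, 1) a) := by
  funext x y t
  exact ((smoothFunctions_differentiableAt a (x, y, t)).hasFDerivAt.comp_hasDerivAt t
    ((hasDerivAt_const t x).prodMk ((hasDerivAt_const t y).prodMk (hasDerivAt_id t)))).deriv

theorem curry3_injective : Function.Injective curry3 := fun _ _ hab =>
  Subtype.ext (funext fun p => congrFun (congrFun (congrFun hab p.1) p.2.1) p.2.2)

/-- A smooth function of `t`, viewed as a smooth function of `(x, y, t)`. -/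
def ofTime (f : ℝ → ℝ) (hf : ContDiff ℝ (⊤ : ℕ∞) f) : smoothFunctions (ℝ × ℝ × ℝ) :=
  ⟨fun p => f p.2.2, hf.comp (contDiff_snd.comp contDiff_snd)⟩

theorem dirDeriv_x_ofTime (f : ℝ → ℝ) (hf : ContDiff ℝ (⊤ : ℕ∞) f) :
    dirDeriv (1, 0, 0) (ofTime f hf) = 0 := by
  apply curry3_injective
  rw [← dx_curry3]
  funext x y t
  exact deriv_const x (f t)

theorem dirDeriv_y_ofTime (f : ℝ → ℝ) (hf : ContDiff ℝ (⊤ : ℕ∞) f) :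
    dirDeriv (0, 1, 0) (ofTime f hf) = 0 := by
  apply curry3_injective
  rw [← dy_curry3]
  funext x y t
  exact deriv_const y (f t)

theorem dirDeriv_t_ofTime (f : ℝ → ℝ) (hf : ContDiff ℝ (⊤ : ℕ∞) f)
    (hf' : ContDiff ℝ (⊤ : ℕ∞) (deriv f)) :
    dirDeriv (0, 0, 1) (ofTime f hf) = ofTime (deriv f) hf' := by
  apply curry3_injective
  rw [← dt_curry3]
  rfl

/-- The full point symmetry algebra `T(f) + Y(g) + X(h) + U(ℓ)` of KP₄
consists of symmetries. -/
theorem stmt17 (w : ℝ → ℝ → ℝ → ℝ) (hw : Smooth3 w) (hsol : KP4 w)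
    (f g h l : ℝ → ℝ) (hf : ContDiff ℝ (⊤ : ℕ∞) f) (hg : ContDiff ℝ (⊤ : ℕ∞) g)
    (hh : ContDiff ℝ (⊤ : ℕ∞) h) (hl : ContDiff ℝ (⊤ : ℕ∞) l) :
    LinKP4 w (fun x y t =>
      f t * dt w x y t
      + (1/4) * deriv f t * (x * dx w x y t + 2 * y * dy w x y t)
      + (1/4) * (w x y t * deriv f t + x * y * deriv (deriv f) t)
      + g t * dy w x y t + (1/2) * x * deriv g t
      + h t * dx w x y t + y * deriv h t
      + l t) := by
  have hderiv : ∀ {k : ℝ → ℝ}, ContDiff ℝ (⊤ : ℕ∞) k → ContDiff ℝ (⊤ : ℕ∞) (deriv k) :=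
    fun hk => (contDiff_infty_iff_deriv.1 hk).2
  let W : smoothFunctions (ℝ × ℝ × ℝ) := ⟨fun p => w p.1 p.2.1 p.2.2, hw⟩
  let X : smoothFunctions (ℝ × ℝ × ℝ) :=
    ⟨fun p => p.1, show ContDiff ℝ (⊤ : ℕ∞) (fun p : ℝ × ℝ × ℝ => p.1) from contDiff_fst⟩
  let Y : smoothFunctions (ℝ × ℝ × ℝ) :=
    ⟨fun p => p.2.1, show ContDiff ℝ (⊤ : ℕ∞) (fun p : ℝ × ℝ × ℝ => p.2.1) from
      contDiff_fst.comp contDiff_snd⟩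
  let c : smoothFunctions (ℝ × ℝ × ℝ) := algebraMap ℝ _ (1 / 4)
  let Dx := dirDeriv ((1, 0, 0) : ℝ × ℝ × ℝ)
  let Dy := dirDeriv ((0, 1, 0) : ℝ × ℝ × ℝ)
  let Dt := dirDeriv ((0, 0, 1) : ℝ × ℝ × ℝ)
  let F := ofTime f hf
  let G := ofTime g hg
  let H := ofTime h hh
  let L := ofTime l hl
  let Q := F * Dt W + c * Dt F * (X * Dx W + 2 * Y * Dy W)
    + c * (W * Dt F + X * Y * Dt (Dt F)) + G * Dy W + 2 * c * X * Dt G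
    + H * Dx W + Y * Dt H + L
  have hW : w = curry3 W := rfl
  have hQ : (fun x y t =>
      f t * dt w x y t
      + (1/4) * deriv f t * (x * dx w x y t + 2 * y * dy w x y t)
      + (1/4) * (w x y t * deriv f t + x * y * deriv (deriv f) t)
      + g t * dy w x y t + (1/2) * x * deriv g t
      + h t * dx w x y t + y * deriv h t
      + l t) = curry3 Q := by
    have hFt : Dt F = ofTime (deriv f) (hderiv hf) := dirDeriv_t_ofTime f hf _
    have hFtt : Dt (ofTime (deriv f) (hderiv hf))
        = ofTime (deriv (deriv f)) (hderiv (hderiv hf)) := dirDeriv_t_ofTime _ _ _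
    have hGt : Dt G = ofTime (deriv g) (hderiv hg) := dirDeriv_t_ofTime g hg _
    have hHt : Dt H = ofTime (deriv h) (hderiv hh) := dirDeriv_t_ofTime h hh _
    funext x y t
    rw [hW, dx_curry3, dy_curry3, dt_curry3]
    simp only [Q, hFt, hFtt, hGt, hHt]
    change _ = f t * curry3 (Dt W) x y t
      + (1/4) * deriv f t * (x * curry3 (Dx W) x y t + 2 * y * curry3 (Dy W) x y t)
      + (1/4) * (curry3 W x y t * deriv f t + x * y * deriv (deriv f) t)
      + g t * curry3 (Dy W) x y t + 2 * (1/4) * x * deriv g t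
      + h t * curry3 (Dx W) x y t + y * deriv h t
      + l t
    simp only [Dx, Dy, Dt]
    ring
  have hc : 4 * c = 1 := by
    ext p
    change (4 : ℝ) * (1 / 4) = 1
    norm_num
  have hsolW : Dx (Dx (Dx (Dx (Dy W)))) + 6 * Dx (Dx W) * Dx (Dy W)
      + 4 * Dx W * Dx (Dx (Dy W)) + 2 * Dx (Dx (Dx W)) * Dy W - 2 * Dx (Dx (Dt W))
      + Dy (Dy (Dy W)) = 0 := by
    rw [hW] at hsol
    simp only [KP4, dx_curry3, dy_curry3, dt_curry3] at hsol
    ext p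
    exact hsol p.1 p.2.1 p.2.2
  have hXx : Dx X = 1 := by
    apply curry3_injective
    rw [← dx_curry3]
    funext x y t
    exact deriv_id x
  have hXy : Dy X = 0 := by
    apply curry3_injective
    rw [← dy_curry3]
    funext x y t
    exact deriv_const y x
  have hXt : Dt X = 0 := by
    apply curry3_injective
    rw [← dt_curry3]
    funext x y t
    exact deriv_const t x
  have hYx : Dx Y = 0 := by
    apply curry3_injective
    rw [← dx_curry3]
    funext x y t
    exact deriv_const x y
  have hYy : Dy Y = 1 := by
    apply curry3_injective
    rw [← dy_curry3]
    funext x y t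
    exact deriv_id y
  have hYt : Dt Y = 0 := by
    apply curry3_injective
    rw [← dt_curry3]
    funext x y t
    exact deriv_const t y
  have key := linearized_KP4_of_derivations Dx Dy Dt (dirDeriv_comm _ _) (dirDeriv_comm _ _)
    (dirDeriv_comm _ _) hc (Dx.map_algebraMap _) (Dy.map_algebraMap _) (Dt.map_algebraMap _)
    hXx hXy hXt hYx hYy hYt
    (dirDeriv_x_ofTime f hf) (dirDeriv_y_ofTime f hf)
    (dirDeriv_x_ofTime g hg) (dirDeriv_y_ofTime g hg)
    (dirDeriv_x_ofTime h hh) (dirDeriv_y_ofTime h hh)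
    (dirDeriv_x_ofTime l hl) (dirDeriv_y_ofTime l hl) hsolW (rfl : Q = _)
  rw [hQ, hW]
  intro x y t
  simp only [dx_curry3, dy_curry3, dt_curry3]
  exact congrFun (congrArg Subtype.val key) (x, y, t)
end
end

section
/- The Kac–Moody symmetry group of KP₄ acts on solutions: let g, h, ℓ : ℝ → ℝ be smooth, let z ∈ ℝ, and let w : ℝ³ → ℝ be a smooth solution of the KP₄ equation. Define v : ℝ³ → ℝ by v(x, y, t) = w(x − z·h(t), y − z·g(t), t) + 2z·ℓ(t) − (z/2)·(x − z·h(t))·g'(t) − z·(y − z·g(t))·h'(t) − (z²/4)·(g'(t)h(t) + 2g(t)h'(t)). Then v is also a smooth solution of the KP₄ equation. -/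
noncomputable section

namespace Smooth3

variable {w : ℝ → ℝ → ℝ → ℝ}

lemma hasDerivAt_curve (hw : Smooth3 w) {a b c : ℝ → ℝ} {a' b' c' s : ℝ}
    (ha : HasDerivAt a a' s) (hb : HasDerivAt b b' s) (hc : HasDerivAt c c' s) :
    HasDerivAt (fun s => w (a s) (b s) (c s))
      (fderiv ℝ (fun p : ℝ × ℝ × ℝ => w p.1 p.2.1 p.2.2) (a s, b s, c s) (a', b', c')) s :=
  HasFDerivAt.comp_hasDerivAt (f := fun s => (a s, b s, c s))
    (l := fun p : ℝ × ℝ × ℝ => w p.1 p.2.1 p.2.2) s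
    ((ContDiff.differentiable hw (by simp)) _).hasFDerivAt (ha.prodMk (hb.prodMk hc))

lemma dx_eq_fderiv (hw : Smooth3 w) (x y t : ℝ) :
    dx w x y t = fderiv ℝ (fun p : ℝ × ℝ × ℝ => w p.1 p.2.1 p.2.2) (x, y, t) (1, 0, 0) :=
  (hw.hasDerivAt_curve (hasDerivAt_id x) (hasDerivAt_const x y) (hasDerivAt_const x t)).deriv

lemma dy_eq_fderiv (hw : Smooth3 w) (x y t : ℝ) :
    dy w x y t = fderiv ℝ (fun p : ℝ × ℝ × ℝ => w p.1 p.2.1 p.2.2) (x, y, t) (0, 1, 0) :=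
  (hw.hasDerivAt_curve (hasDerivAt_const y x) (hasDerivAt_id y) (hasDerivAt_const y t)).deriv

lemma dt_eq_fderiv (hw : Smooth3 w) (x y t : ℝ) :
    dt w x y t = fderiv ℝ (fun p : ℝ × ℝ × ℝ => w p.1 p.2.1 p.2.2) (x, y, t) (0, 0, 1) :=
  (hw.hasDerivAt_curve (hasDerivAt_const t x) (hasDerivAt_const t y) (hasDerivAt_id t)).deriv

lemma contDiff_fderiv_apply (hw : Smooth3 w) (v : ℝ × ℝ × ℝ) :
    ContDiff ℝ (⊤ : ℕ∞)
      (fun p => fderiv ℝ (fun p : ℝ × ℝ × ℝ => w p.1 p.2.1 p.2.2) p v) :=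
  (ContDiff.fderiv_right hw (by simp)).clm_apply contDiff_const

lemma dx (hw : Smooth3 w) : Smooth3 (dx w) := by
  simpa only [Smooth3, hw.dx_eq_fderiv] using hw.contDiff_fderiv_apply (1, 0, 0)

lemma dy (hw : Smooth3 w) : Smooth3 (dy w) := by
  simpa only [Smooth3, hw.dy_eq_fderiv] using hw.contDiff_fderiv_apply (0, 1, 0)

lemma dt (hw : Smooth3 w) : Smooth3 (dt w) := by
  simpa only [Smooth3, hw.dt_eq_fderiv] using hw.contDiff_fderiv_apply (0, 0, 1)

/-- The chain rule along a curve, in terms of the partial derivatives. -/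
lemma hasDerivAt_comp (hw : Smooth3 w) {a b c : ℝ → ℝ} {a' b' c' s : ℝ}
    (ha : HasDerivAt a a' s) (hb : HasDerivAt b b' s) (hc : HasDerivAt c c' s) :
    HasDerivAt (fun s => w (a s) (b s) (c s))
      (a' * _root_.dx w (a s) (b s) (c s) + b' * _root_.dy w (a s) (b s) (c s)
        + c' * _root_.dt w (a s) (b s) (c s)) s := by
  convert hw.hasDerivAt_curve ha hb hc using 1
  have hv : ((a', b', c') : ℝ × ℝ × ℝ)
      = a' • ((1, 0, 0) : ℝ × ℝ × ℝ) + b' • ((0, 1, 0) : ℝ × ℝ × ℝ)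
        + c' • ((0, 0, 1) : ℝ × ℝ × ℝ) := by
    simp
  rw [hv, map_add, map_add, map_smul, map_smul, map_smul, hw.dx_eq_fderiv, hw.dy_eq_fderiv,
    hw.dt_eq_fderiv]
  simp only [smul_eq_mul]

lemma hasDerivAt_x_sub (hw : Smooth3 w) (p y t x : ℝ) :
    HasDerivAt (fun s => w (s - p) y t) (_root_.dx w (x - p) y t) x := by
  simpa using hw.hasDerivAt_comp ((hasDerivAt_id x).sub_const p) (hasDerivAt_const x y)
    (hasDerivAt_const x t)

lemma hasDerivAt_y_sub (hw : Smooth3 w) (x q t y : ℝ) :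
    HasDerivAt (fun s => w x (s - q) t) (_root_.dy w x (y - q) t) y := by
  simpa using hw.hasDerivAt_comp (hasDerivAt_const y x) ((hasDerivAt_id y).sub_const q)
    (hasDerivAt_const y t)

end Smooth3

section Shift

variable {w : ℝ → ℝ → ℝ → ℝ} {p q : ℝ → ℝ}

lemma dx_shift_add_affine (hw : Smooth3 w) (a b c : ℝ → ℝ) :
    dx (fun x y t => w (x - p t) (y - q t) t + a t * x + b t * y + c t)
      = fun x y t => dx w (x - p t) (y - q t) t + a t := by
  funext x y t
  have h := (((hw.hasDerivAt_x_sub (p t) (y - q t) t x).add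
    ((hasDerivAt_id x).const_mul (a t))).add_const (b t * y)).add_const (c t)
  exact h.deriv.trans (by rw [mul_one])

lemma dy_shift_add_affine (hw : Smooth3 w) (a b c : ℝ → ℝ) :
    dy (fun x y t => w (x - p t) (y - q t) t + a t * x + b t * y + c t)
      = fun x y t => dy w (x - p t) (y - q t) t + b t := by
  funext x y t
  have h := (((hw.hasDerivAt_y_sub (x - p t) (q t) t y).add_const (a t * x)).add
    ((hasDerivAt_id y).const_mul (b t))).add_const (c t)
  exact h.deriv.trans (by rw [mul_one])

lemma dx_shift_add (hw : Smooth3 w) (a : ℝ → ℝ) :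
    dx (fun x y t => w (x - p t) (y - q t) t + a t)
      = fun x y t => dx w (x - p t) (y - q t) t := by
  simpa using dx_shift_add_affine (p := p) (q := q) hw 0 0 a

lemma dy_shift_add (hw : Smooth3 w) (a : ℝ → ℝ) :
    dy (fun x y t => w (x - p t) (y - q t) t + a t)
      = fun x y t => dy w (x - p t) (y - q t) t := by
  simpa using dy_shift_add_affine (p := p) (q := q) hw 0 0 a

lemma dx_shift (hw : Smooth3 w) :
    dx (fun x y t => w (x - p t) (y - q t) t) = fun x y t => dx w (x - p t) (y - q t) t := by
  simpa using dx_shift_add (p := p) (q := q) hw 0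

lemma dy_shift (hw : Smooth3 w) :
    dy (fun x y t => w (x - p t) (y - q t) t) = fun x y t => dy w (x - p t) (y - q t) t := by
  simpa using dy_shift_add (p := p) (q := q) hw 0

lemma dt_shift_add_affine (hw : Smooth3 w) {a b c : ℝ → ℝ}
    (hp : Differentiable ℝ p) (hq : Differentiable ℝ q) (ha : Differentiable ℝ a)
    (hb : Differentiable ℝ b) (hc : Differentiable ℝ c) :
    dt (fun x y t => w (x - p t) (y - q t) t + a t * x + b t * y + c t)
      = fun x y t => dt w (x - p t) (y - q t) t - deriv p t * dx w (x - p t) (y - q t) t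
          - deriv q t * dy w (x - p t) (y - q t) t
          + deriv a t * x + deriv b t * y + deriv c t := by
  funext x y t
  have h := (((hw.hasDerivAt_comp ((hp t).hasDerivAt.const_sub x) ((hq t).hasDerivAt.const_sub y)
    (hasDerivAt_id t)).add ((ha t).hasDerivAt.mul_const x)).add
      ((hb t).hasDerivAt.mul_const y)).add (hc t).hasDerivAt
  refine h.deriv.trans ?_
  simp only [id]
  ring

lemma dx_dx_dt_shift_add_affine (hw : Smooth3 w) {a b c : ℝ → ℝ}
    (hp : Differentiable ℝ p) (hq : Differentiable ℝ q) (ha : Differentiable ℝ a)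
    (hb : Differentiable ℝ b) (hc : Differentiable ℝ c) :
    dx (dx (dt (fun x y t => w (x - p t) (y - q t) t + a t * x + b t * y + c t)))
      = fun x y t => dx (dx (dt w)) (x - p t) (y - q t) t
          - deriv p t * dx (dx (dx w)) (x - p t) (y - q t) t
          - deriv q t * dx (dx (dy w)) (x - p t) (y - q t) t := by
  have key : dx (dt (fun x y t => w (x - p t) (y - q t) t + a t * x + b t * y + c t))
      = fun x y t => dx (dt w) (x - p t) (y - q t) t
          - deriv p t * dx (dx w) (x - p t) (y - q t) t
          - deriv q t * dx (dy w) (x - p t) (y - q t) t + deriv a t := by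
    rw [dt_shift_add_affine hw hp hq ha hb hc]
    funext x y t
    have h := (((((hw.dt.hasDerivAt_x_sub (p t) (y - q t) t x).sub
      ((hw.dx.hasDerivAt_x_sub (p t) (y - q t) t x).const_mul (deriv p t))).sub
      ((hw.dy.hasDerivAt_x_sub (p t) (y - q t) t x).const_mul (deriv q t))).add
      ((hasDerivAt_id x).const_mul (deriv a t))).add_const (deriv b t * y)).add_const (deriv c t)
    exact h.deriv.trans (by rw [mul_one])
  rw [key]
  funext x y t
  exact ((((hw.dt.dx.hasDerivAt_x_sub (p t) (y - q t) t x).sub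
    ((hw.dx.dx.hasDerivAt_x_sub (p t) (y - q t) t x).const_mul (deriv p t))).sub
    ((hw.dy.dx.hasDerivAt_x_sub (p t) (y - q t) t x).const_mul (deriv q t))).add_const
    (deriv a t)).deriv

lemma KP4.shift_add_affine (hsol : KP4 w) (hw : Smooth3 w) {a b c : ℝ → ℝ}
    (hp : Differentiable ℝ p) (hq : Differentiable ℝ q) (ha : Differentiable ℝ a)
    (hb : Differentiable ℝ b) (hc : Differentiable ℝ c)
    (haq : ∀ t, 2 * a t = -deriv q t) (hbp : ∀ t, b t = -deriv p t) :
    KP4 (fun x y t => w (x - p t) (y - q t) t + a t * x + b t * y + c t) := by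
  intro x y t
  rw [dx_dx_dt_shift_add_affine hw hp hq ha hb hc, dx_shift_add_affine hw,
    dy_shift_add_affine hw, dx_shift_add hw.dx, dx_shift_add hw.dy, dy_shift_add hw.dy,
    dx_shift hw.dx.dx, dx_shift hw.dy.dx, dx_shift hw.dy.dx.dx, dx_shift hw.dy.dx.dx.dx,
    dy_shift hw.dy.dy]
  linear_combination hsol (x - p t) (y - q t) t
    + 2 * dx (dx (dy w)) (x - p t) (y - q t) t * haq t
    + 2 * dx (dx (dx w)) (x - p t) (y - q t) t * hbp t

lemma Smooth3.shift_add_affine (hw : Smooth3 w) {a b c : ℝ → ℝ}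
    (hp : ContDiff ℝ (⊤ : ℕ∞) p) (hq : ContDiff ℝ (⊤ : ℕ∞) q) (ha : ContDiff ℝ (⊤ : ℕ∞) a)
    (hb : ContDiff ℝ (⊤ : ℕ∞) b) (hc : ContDiff ℝ (⊤ : ℕ∞) c) :
    Smooth3 (fun x y t => w (x - p t) (y - q t) t + a t * x + b t * y + c t) := by
  have hshift : ContDiff ℝ (⊤ : ℕ∞)
      (fun r : ℝ × ℝ × ℝ => w (r.1 - p r.2.2) (r.2.1 - q r.2.2) r.2.2) :=
    ContDiff.comp (g := fun r : ℝ × ℝ × ℝ => w r.1 r.2.1 r.2.2)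
      (f := fun r : ℝ × ℝ × ℝ => (r.1 - p r.2.2, r.2.1 - q r.2.2, r.2.2)) hw (by fun_prop)
  exact ((hshift.add (by fun_prop : ContDiff ℝ (⊤ : ℕ∞) fun r : ℝ × ℝ × ℝ => a r.2.2 * r.1)).add
    (by fun_prop : ContDiff ℝ (⊤ : ℕ∞) fun r : ℝ × ℝ × ℝ => b r.2.2 * r.2.1)).add
    (by fun_prop : ContDiff ℝ (⊤ : ℕ∞) fun r : ℝ × ℝ × ℝ => c r.2.2)

end Shift

/-- The finite Kac–Moody group transformation of KP₄ maps solutions to solutions. -/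
theorem stmt18 (g h l : ℝ → ℝ) (hg : ContDiff ℝ (⊤ : ℕ∞) g) (hh : ContDiff ℝ (⊤ : ℕ∞) h)
    (hl : ContDiff ℝ (⊤ : ℕ∞) l) (z : ℝ)
    (w : ℝ → ℝ → ℝ → ℝ) (hw : Smooth3 w) (hsol : KP4 w) :
    Smooth3 (fun x y t =>
      w (x - z * h t) (y - z * g t) t + 2 * z * l t
      - (z / 2) * (x - z * h t) * deriv g t
      - z * (y - z * g t) * deriv h t
      - (z ^ 2 / 4) * (deriv g t * h t + 2 * g t * deriv h t)) ∧
    KP4 (fun x y t =>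
      w (x - z * h t) (y - z * g t) t + 2 * z * l t
      - (z / 2) * (x - z * h t) * deriv g t
      - z * (y - z * g t) * deriv h t
      - (z ^ 2 / 4) * (deriv g t * h t + 2 * g t * deriv h t)) := by
  have hg' : ContDiff ℝ (⊤ : ℕ∞) (deriv g) := (contDiff_infty_iff_deriv.mp hg).2
  have hh' : ContDiff ℝ (⊤ : ℕ∞) (deriv h) := (contDiff_infty_iff_deriv.mp hh).2
  have hp : ContDiff ℝ (⊤ : ℕ∞) (fun t => z * h t) := by fun_prop
  have hq : ContDiff ℝ (⊤ : ℕ∞) (fun t => z * g t) := by fun_prop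
  have ha : ContDiff ℝ (⊤ : ℕ∞) (fun t => -(z / 2) * deriv g t) := by fun_prop
  have hb : ContDiff ℝ (⊤ : ℕ∞) (fun t => -z * deriv h t) := by fun_prop
  have hc : ContDiff ℝ (⊤ : ℕ∞) (fun t => 2 * z * l t
      + (z ^ 2 / 4) * (deriv g t * h t + 2 * g t * deriv h t)) := by fun_prop
  have hv : (fun x y t =>
      w (x - z * h t) (y - z * g t) t + 2 * z * l t
      - (z / 2) * (x - z * h t) * deriv g t
      - z * (y - z * g t) * deriv h t
      - (z ^ 2 / 4) * (deriv g t * h t + 2 * g t * deriv h t))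
      = fun x y t => w (x - z * h t) (y - z * g t) t + -(z / 2) * deriv g t * x
        + -z * deriv h t * y
        + (2 * z * l t + (z ^ 2 / 4) * (deriv g t * h t + 2 * g t * deriv h t)) := by
    funext x y t
    ring
  rw [hv]
  refine ⟨hw.shift_add_affine hp hq ha hb hc, hsol.shift_add_affine hw
    (hp.differentiable (by simp)) (hq.differentiable (by simp)) (ha.differentiable (by simp))
    (hb.differentiable (by simp)) (hc.differentiable (by simp)) (fun t => ?_) (fun t => ?_)⟩
  · rw [deriv_const_mul_field]
    ring
  · rw [deriv_const_mul_field]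
    ring
end
end
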